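/- If the demand satisfies d⁻ > C and a constant speed limit u with v1 < u ≤ v_f is applied, then the link queue system has a unique equilibrium, which is congested: k* ∈ [0, k_j] satisfies F(u, k*) = G(k*) if and only if k* = k2 = k_j − (1−Δ)C/w, with equilibrium flow (1−Δ)C. -/

import Mathlib

/-- In-flux function of the link queue model:
`F(u,k) = min{d⁻, u*w*k_j/(u+w), w*(k_j−k)}`. -/
noncomputable def influx (dm w kj u k : ℝ) : ℝ :=
  min dm (min (u * w * kj / (u + w)) (w * (kj - k)))

/-- Out-flux (discharging flow-rate) with capacity drop:
`G(k) = v_f*k` if `k ≤ k1 = C/v_f`, and `(1−Δ)*C` otherwise. -/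
noncomputable def outflux (vf C Δ k : ℝ) : ℝ :=
  if k ≤ C / vf then vf * k else (1 - Δ) * C

/-- With demand `d⁻ > C` and a constant speed limit `u` with `v1 < u ≤ v_f`,
the unique equilibrium in `[0, k_j]` is the congested `k2 = k_j − (1−Δ)C/w`,
with equilibrium flow `(1−Δ)C`. -/
theorem high_speed_limit_high_demand_unique_congested_equilibrium
    (vf w kj C Δ dm u : ℝ)
    (hvf : 0 < vf) (hw : 0 < w) (hkj : 0 < kj)
    (hC0 : 0 < C) (hCub : C < vf * w * kj / (vf + w))
    (hΔ0 : 0 < Δ) (hΔ1 : Δ < 1)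
    (hdm : C < dm)
    (hu1 : C * w / (kj * w - C) < u) (hu2 : u ≤ vf) :
    (∀ k : ℝ, 0 ≤ k → k ≤ kj →
      (influx dm w kj u k = outflux vf C Δ k ↔ k = kj - (1 - Δ) * C / w)) ∧
    outflux vf C Δ (kj - (1 - Δ) * C / w) = (1 - Δ) * C := by
  have hjam : C * (vf + w) < vf * w * kj := (lt_div_iff₀ (by positivity)).mp hCub
  have hCw : C < kj * w := by
    by_contra! h
    nlinarith [mul_le_mul_of_nonneg_left h hvf.le, mul_pos hC0 hw]
  have hpos : 0 < kj * w - C := by linarith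
  have hu : 0 < u := lt_trans (by positivity) hu1
  have hcap : C < u * w * kj / (u + w) := by
    rw [lt_div_iff₀ (by positivity)]
    have := (div_lt_iff₀ hpos).mp hu1
    linarith
  have hcong : C < w * (kj - C / vf) := by
    have hmul : C / vf * vf = C := div_mul_cancel₀ C hvf.ne'
    by_contra! h
    have := mul_le_mul_of_nonneg_left h hvf.le
    have hexp : vf * (w * (kj - C / vf)) = vf * w * kj - w * (C / vf * vf) := by ring
    rw [hexp, hmul] at this
    linarith
  have hdrop : (1 - Δ) * C < C := by nlinarith
  have heq : w * (kj - (kj - (1 - Δ) * C / w)) = (1 - Δ) * C := by field_simp; ring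
  have hk2 : ¬ kj - (1 - Δ) * C / w ≤ C / vf := by
    intro h
    have := mul_le_mul_of_nonneg_left (sub_le_sub_left h kj) hw.le
    linarith
  refine ⟨fun k _ _ => ⟨fun h => ?_, ?_⟩, if_neg hk2⟩
  · unfold influx outflux at h
    split_ifs at h with hk
    · have hflow : vf * k ≤ C := by
        have := (le_div_iff₀ hvf).mp hk
        linarith
      have hin : C < w * (kj - k) :=
        hcong.trans_le (mul_le_mul_of_nonneg_left (sub_le_sub_left hk kj) hw.le)
      have := lt_min hdm (lt_min hcap hin)
      linarith
    · have hlin : w * (kj - k) = (1 - Δ) * C := by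
        rcases min_choice dm (min (u * w * kj / (u + w)) (w * (kj - k))) with h1 | h1
        · linarith
        · rcases min_choice (u * w * kj / (u + w)) (w * (kj - k)) with h2 | h2 <;> linarith
      have := mul_left_cancel₀ hw.ne' (hlin.trans heq.symm)
      linarith
  · rintro rfl
    rw [influx, outflux, if_neg hk2, heq, min_eq_right (hdrop.trans hcap).le,
      min_eq_right (hdrop.trans hdm).le]
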